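/- Every graph G has an imbalance-optimal ordering that is clean: for every inclusion-wise maximal set Y of true twins, the vertices of Y appear consecutively in the ordering. -/

import Mathlib

/-- Number of neighbors of `v` preceding `v` in the ordering `σ`. -/
noncomputable def predCount {V : Type*} [Fintype V] (G : SimpleGraph V)
    (σ : V ≃ Fin (Fintype.card V)) (v : V) : ℕ :=
  Nat.card {u : V // G.Adj v u ∧ σ u < σ v}

/-- Number of neighbors of `v` following `v` in the ordering `σ`. -/
noncomputable def succCount {V : Type*} [Fintype V] (G : SimpleGraph V)
    (σ : V ≃ Fin (Fintype.card V)) (v : V) : ℕ :=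
  Nat.card {u : V // G.Adj v u ∧ σ v < σ u}

/-- The imbalance of the ordering `σ`. -/
noncomputable def imbalance {V : Type*} [Fintype V] (G : SimpleGraph V)
    (σ : V ≃ Fin (Fintype.card V)) : ℤ :=
  ∑ v : V, |(predCount G σ v : ℤ) - (succCount G σ v : ℤ)|

/-- `Y` is a set of true twins: any two of its vertices have the same closed neighborhood. -/
def IsTrueTwinSet {V : Type*} (G : SimpleGraph V) (Y : Set V) : Prop :=
  ∀ u ∈ Y, ∀ w ∈ Y, ∀ x : V, (G.Adj u x ∨ x = u) ↔ (G.Adj w x ∨ x = w)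

open Classical in
/-- weight -/
noncomputable def adjW {V : Type*} (G : SimpleGraph V) (v u : V) : ℤ := if G.Adj v u then 2 else 0

/-- total weight of a list -/
noncomputable def lw {V : Type*} (G : SimpleGraph V) : List V → V → ℤ
  | [], _ => 0
  | v :: l, u => adjW G v u + lw G l u

/-- cost of a list started in state `f` -/
noncomputable def lcost {V : Type*} (G : SimpleGraph V) : (V → ℤ) → List V → ℤ
  | _, [] => 0
  | f, v :: l => |f v| + lcost G (fun u => f u + adjW G v u) l

/-- twins -/
def Tw {V : Type*} (G : SimpleGraph V) (u w : V) : Prop :=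
  ∀ x : V, (G.Adj u x ∨ x = u) ↔ (G.Adj w x ∨ x = w)

section aux
variable {V : Type*} (G : SimpleGraph V)

theorem adjW_nonneg (v u : V) : 0 ≤ adjW G v u := by
  unfold adjW; split_ifs <;> norm_num

theorem lw_nonneg (l : List V) (u : V) : 0 ≤ lw G l u := by
  induction l with
  | nil => simp [lw]
  | cons v l ih => have := adjW_nonneg G v u; simp only [lw]; linarith

theorem lw_append (l m : List V) (u : V) : lw G (l ++ m) u = lw G l u + lw G m u := by
  induction l with
  | nil => simp [lw]
  | cons v l ih => simp only [List.cons_append, lw, ih]; ring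

theorem lcost_append (l m : List V) (f : V → ℤ) :
    lcost G f (l ++ m) = lcost G f l + lcost G (fun u => f u + lw G l u) m := by
  induction l generalizing f with
  | nil => simp [lw, lcost]
  | cons v l ih =>
    simp only [List.cons_append, lw, lcost, ih, add_assoc]

theorem Tw.adj_iff {G : SimpleGraph V} {u w x : V} (h : Tw G u w) (hu : x ≠ u) (hw : x ≠ w) :
    G.Adj u x ↔ G.Adj w x := by
  have := h x
  simpa [hu, hw] using this

theorem Tw.adj {G : SimpleGraph V} {u w : V} (h : Tw G u w) (hu : u ≠ w) : G.Adj u w := by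
  have := (h w).2 (Or.inr rfl)
  rcases this with h | h
  · exact h
  · exact absurd h.symm hu

theorem Tw.symm {G : SimpleGraph V} {u w : V} (h : Tw G u w) : Tw G w u := fun x => (h x).symm

theorem Tw.trans {G : SimpleGraph V} {u w z : V} (h : Tw G u w) (h' : Tw G w z) : Tw G u z :=
  fun x => (h x).trans (h' x)

theorem lw_tw {u w : V} (h : Tw G u w) (l : List V) (hu : u ∉ l) (hw : w ∉ l) :
    lw G l u = lw G l w := by
  induction l with
  | nil => rfl
  | cons v l ih =>
    simp only [List.mem_cons, not_or] at hu hw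
    have := h.adj_iff (x := v) (Ne.symm hu.1) (Ne.symm hw.1)
    have h2 : G.Adj v u ↔ G.Adj v w := by
      rw [G.adj_comm v u, G.adj_comm v w, this]
    simp only [lw, ih hu.2 hw.2, adjW]
    by_cases h3 : G.Adj v u
    · rw [if_pos h3, if_pos (h2.1 h3)]
    · rw [if_neg h3, if_neg (fun h => h3 (h2.2 h))]

theorem lw_all {x : V} (l : List V) (h : ∀ v ∈ l, G.Adj v x) : lw G l x = 2 * l.length := by
  induction l with
  | nil => simp [lw]
  | cons v l ih =>
    simp only [List.mem_cons, forall_eq_or_imp] at h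
    simp only [lw, ih h.2, adjW, h.1, if_true, List.length_cons]; push_cast; ring

theorem lw_none {x : V} (l : List V) (h : ∀ v ∈ l, ¬ G.Adj v x) : lw G l x = 0 := by
  induction l with
  | nil => simp [lw]
  | cons v l ih =>
    simp only [List.mem_cons, forall_eq_or_imp] at h
    simp only [lw, ih h.2, adjW, h.1, if_false]; rfl

/-- block sum -/
def bs (t : ℤ) (n : ℕ) : ℤ := ∑ i ∈ Finset.range n, |t + 2 * i|

theorem lcost_block (A : List V) (f : V → ℤ) (α : ℤ) (hn : A.Nodup)
    (hT : ∀ u ∈ A, ∀ w ∈ A, Tw G u w) (hf : ∀ u ∈ A, f u = α) :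
    lcost G f A = bs α A.length := by
  induction A generalizing f α with
  | nil => simp [lcost, bs]
  | cons v l ih =>
    rw [List.nodup_cons] at hn
    have := ih (fun u => f u + adjW G v u) (α + 2) hn.2
      (fun u hu w hw => hT u (List.mem_cons_of_mem _ hu) w (List.mem_cons_of_mem _ hw)) (by
        intro u hu
        have h1 : G.Adj v u := (hT v (by simp) u (List.mem_cons_of_mem _ hu)).adj (by
          rintro rfl; exact hn.1 hu)
        simp [hf u (List.mem_cons_of_mem _ hu), adjW, h1])
    simp only [lcost, this, hf v (by simp), bs, List.length_cons]
    rw [Finset.sum_range_succ']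
    push_cast
    simp only [mul_zero, add_zero]
    rw [add_comm]
    congr 1
    apply Finset.sum_congr rfl
    intros; congr 1; ring

theorem bs_shift (t : ℤ) (a c : ℕ) : bs (t + 2 * c) a - bs t a =
    ∑ i ∈ Finset.range a, ∑ j ∈ Finset.range c, (|t + 2 * i + 2 * j + 2| - |t + 2 * i + 2 * j|) := by
  unfold bs
  rw [← Finset.sum_sub_distrib]
  apply Finset.sum_congr rfl
  intro i _
  have := Finset.sum_range_sub (fun j : ℕ => |t + 2 * i + 2 * (j : ℤ)|) c
  push_cast at this
  simp only [mul_add, mul_one, mul_zero, add_zero, ← add_assoc] at this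
  rw [this]
  congr 2; ring

theorem bs_swap (α γ : ℤ) (a c : ℕ) (h : α ≤ γ ∨ α + 2 * a + 2 * c ≤ 2 ∨ 0 ≤ γ) :
    bs γ c + bs (α + 2 * c) a ≤ bs α a + bs (γ + 2 * a) c := by
  have h1 := bs_shift α a c
  have h2 := bs_shift γ c a
  rw [Finset.sum_comm] at h2
  have : bs (α + 2 * c) a - bs α a ≤ bs (γ + 2 * a) c - bs γ c := by
    rw [h1, h2]
    apply Finset.sum_le_sum
    intro i hi
    apply Finset.sum_le_sum
    intro j hj
    rw [Finset.mem_range] at hi hj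
    grind
  linarith

/-- twin block -/
def Blk (A : List V) : Prop := A ≠ [] ∧ ∀ u ∈ A, ∀ w ∈ A, Tw G u w

theorem Blk.dich {G : SimpleGraph V} {A C : List V} (hA : Blk G A) (hC : Blk G C)
    (hd : A.Disjoint C) :
    (∀ u ∈ A, ∀ w ∈ C, G.Adj u w) ∨ (∀ u ∈ A, ∀ w ∈ C, ¬ G.Adj u w) := by
  have key : ∀ u ∈ A, ∀ w ∈ C, ∀ u' ∈ A, ∀ w' ∈ C, G.Adj u w → G.Adj u' w' := by
    intro u hu w hw u' hu' w' hw' h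
    have ne : ∀ x ∈ A, ∀ y ∈ C, x ≠ y := fun x hx y hy e => hd hx (e ▸ hy)
    have h1 := ((hA.2 u hu u' hu').adj_iff (ne u hu w hw).symm (ne u' hu' w hw).symm).1 h
    exact (((hC.2 w hw w' hw').adj_iff (ne u' hu' w hw) (ne u' hu' w' hw')).1 h1.symm).symm
  by_cases h : ∃ u ∈ A, ∃ w ∈ C, G.Adj u w
  · obtain ⟨u, hu, w, hw, h⟩ := h
    left; intro u' hu' w' hw'; exact key u hu w hw u' hu' w' hw' h
  · right; push Not at h; exact h

theorem swap_cost {A C : List V} (hA : Blk G A) (hC : Blk G C) (hn : (A ++ C).Nodup)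
    (f : V → ℤ) (α γ : ℤ) (hfA : ∀ u ∈ A, f u = α) (hfC : ∀ u ∈ C, f u = γ)
    (h : (∃ u ∈ A, ∃ w ∈ C, G.Adj u w) → 
      α ≤ γ ∨ α + 2 * A.length + 2 * C.length ≤ 2 ∨ 0 ≤ γ) :
    lcost G f (C ++ A) ≤ lcost G f (A ++ C) := by
  obtain ⟨nA, nC, hd⟩ := List.nodup_append'.1 hn
  rw [lcost_append, lcost_append, lcost_block G A f α nA hA.2 hfA,
    lcost_block G C f γ nC hC.2 hfC]
  rcases hA.dich hC hd with h1 | h1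
  · rw [lcost_block G A _ (α + 2 * C.length) nA hA.2, lcost_block G C _ (γ + 2 * A.length) nC hC.2]
    · apply bs_swap
      apply h
      obtain ⟨u, hu⟩ := List.exists_mem_of_ne_nil _ hA.1
      obtain ⟨w, hw⟩ := List.exists_mem_of_ne_nil _ hC.1
      exact ⟨u, hu, w, hw, h1 u hu w hw⟩
    · intro u hu
      rw [hfC u hu, lw_all]; intro v hv; exact h1 v hv u hu
    · intro u hu
      rw [hfA u hu, lw_all]; intro v hv; exact (h1 u hu v hv).symm
  · rw [lcost_block G A _ α nA hA.2, lcost_block G C _ γ nC hC.2]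
    · linarith
    · intro u hu
      rw [hfC u hu, lw_none, add_zero]; intro v hv; exact h1 v hv u hu
    · intro u hu
      rw [hfA u hu, lw_none, add_zero]; intro v hv h; exact (h1 u hu v hv) h.symm

theorem lw_perm {l m : List V} (h : l.Perm m) : lw G l = lw G m := by
  funext u
  induction h with
  | nil => rfl
  | cons x _ ih => simp [lw, ih]
  | swap x y l => simp [lw]; ring
  | trans _ _ h1 h2 => exact h1.trans h2

theorem swap_ctx {X Y : List V} (h : X.Perm Y) (f : V → ℤ) (P Q : List V)
    (hc : lcost G (fun u => f u + lw G P u) X ≤ lcost G (fun u => f u + lw G P u) Y) :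
    lcost G f (P ++ (X ++ Q)) ≤ lcost G f (P ++ (Y ++ Q)) := by
  simp only [lcost_append, lw_perm G h]
  linarith

/-- state constant on twin sets -/
def TwInv (f : V → ℤ) : Prop := ∀ u w, Tw G u w → f u = f w

theorem reduce (f : V → ℤ) (hf : TwInv G f) (n : ℕ) : ∀ (L : List (List V)) (A : List V)
    (S : List (List V)) (B : List V) (R : List (List V)), S.length = n →
    (∀ X ∈ L ++ A :: (S ++ B :: R), Blk G X) → (L ++ A :: (S ++ B :: R)).flatten.Nodup →
    (∀ u ∈ A, ∀ w ∈ B, Tw G u w) →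
    ∃ M : List (List V), M.length < (L ++ A :: (S ++ B :: R)).length ∧ (∀ X ∈ M, Blk G X) ∧
      M.flatten.Perm (L ++ A :: (S ++ B :: R)).flatten ∧
      lcost G f M.flatten ≤ lcost G f (L ++ A :: (S ++ B :: R)).flatten := by
  induction n with
  | zero =>
    intro L A S B R hS hB hn hT
    obtain rfl := List.length_eq_zero_iff.1 hS
    refine ⟨L ++ (A ++ B) :: R, by simp, ?_, by simp, by simp⟩
    have hA : Blk G A := hB A (by simp)
    have hB' : Blk G B := hB B (by simp)
    intro X hX
    simp only [List.mem_append, List.mem_cons] at hX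
    rcases hX with hX | rfl | hX
    · exact hB X (by simp [hX])
    · refine ⟨by simp [hA.1], ?_⟩
      intro u hu w hw
      rw [List.mem_append] at hu hw
      rcases hu with hu | hu <;> rcases hw with hw | hw
      · exact hA.2 u hu w hw
      · exact hT u hu w hw
      · exact (hT w hw u hu).symm
      · exact hB'.2 u hu w hw
    · exact hB X (by simp [hX])
  | succ n ih =>
    intro L A S B R hS hB hn hT
    have hA : Blk G A := hB A (by simp)
    have hB' : Blk G B := hB B (by simp)
    obtain ⟨a, ha⟩ := List.exists_mem_of_ne_nil _ hA.1
    obtain ⟨b, hb⟩ := List.exists_mem_of_ne_nil _ hB'.1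
    have left : ∀ C S', S = C :: S' →
        lcost G (fun u => f u + lw G L.flatten u) (C ++ A) ≤
          lcost G (fun u => f u + lw G L.flatten u) (A ++ C) →
        ∃ M : List (List V), M.length < (L ++ A :: (S ++ B :: R)).length ∧ (∀ X ∈ M, Blk G X) ∧
          M.flatten.Perm (L ++ A :: (S ++ B :: R)).flatten ∧
          lcost G f M.flatten ≤ lcost G f (L ++ A :: (S ++ B :: R)).flatten := by
      rintro C S' rfl hc
      have hp : ((L ++ [C]) ++ A :: (S' ++ B :: R)).Perm (L ++ A :: (C :: S' ++ B :: R)) := by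
        simp only [List.append_assoc, List.cons_append, List.nil_append]
        exact (List.Perm.swap _ _ _).append_left L
      obtain ⟨M, h1, h2, h3, h4⟩ := ih (L ++ [C]) A S' B R (by simpa using hS)
        (fun X hX => hB X (hp.mem_iff.1 hX)) (hp.flatten.nodup_iff.2 hn) hT
      refine ⟨M, h1.trans_eq hp.length_eq, h2, h3.trans hp.flatten, h4.trans ?_⟩
      have := swap_ctx G (List.perm_append_comm (l₁ := C) (l₂ := A)) f L.flatten
        (S' ++ B :: R).flatten hc
      simpa using this
    have right : ∀ C S', S = S' ++ [C] →
        lcost G (fun u => f u + lw G (L ++ A :: S').flatten u) (B ++ C) ≤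
          lcost G (fun u => f u + lw G (L ++ A :: S').flatten u) (C ++ B) →
        ∃ M : List (List V), M.length < (L ++ A :: (S ++ B :: R)).length ∧ (∀ X ∈ M, Blk G X) ∧
          M.flatten.Perm (L ++ A :: (S ++ B :: R)).flatten ∧
          lcost G f M.flatten ≤ lcost G f (L ++ A :: (S ++ B :: R)).flatten := by
      rintro C S' rfl hc
      have hp : (L ++ A :: (S' ++ B :: (C :: R))).Perm (L ++ A :: ((S' ++ [C]) ++ B :: R)) := by
        simp only [List.append_assoc, List.cons_append, List.nil_append]
        exact (((List.Perm.swap _ _ _).append_left S').cons A).append_left L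
      obtain ⟨M, h1, h2, h3, h4⟩ := ih L A S' B (C :: R) (by simpa using hS)
        (fun X hX => hB X (hp.mem_iff.1 hX)) (hp.flatten.nodup_iff.2 hn) hT
      refine ⟨M, h1.trans_eq hp.length_eq, h2, h3.trans hp.flatten, h4.trans ?_⟩
      have := swap_ctx G (List.perm_append_comm (l₁ := B) (l₂ := C)) f (L ++ A :: S').flatten
        R.flatten hc
      simpa using this
    have cst : ∀ (P : List V) (X : List V), Blk G X → P.Disjoint X → ∀ x ∈ X, ∀ u ∈ X,
        f u + lw G P u = f x + lw G P x := by
      intro P X hX hd x hx u hu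
      rw [hf u x (hX.2 u hu x hx), lw_tw G (hX.2 u hu x hx) P (fun h => hd h hu)
        (fun h => hd h hx)]
    rcases S with _ | ⟨C, S'⟩
    · simp at hS
    have hC : Blk G C := hB C (by simp)
    obtain ⟨c, hc⟩ := List.exists_mem_of_ne_nil _ hC.1
    have hab := hT a ha b hb
    have hneab : a ≠ b := by
      rintro rfl
      simp [List.nodup_append] at hn
      grind
    have haL : a ∉ L.flatten := by
      simp [List.nodup_append] at hn ⊢
      grind
    have hbL : b ∉ L.flatten := by
      simp [List.nodup_append] at hn ⊢
      grind
    have hALd : L.flatten.Disjoint A := by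
      simp [List.nodup_append, List.Disjoint] at hn ⊢
      grind
    have hCLd : L.flatten.Disjoint C := by
      simp [List.nodup_append, List.Disjoint] at hn ⊢
      grind
    have hACn : (A ++ C).Nodup := by
      simp [List.nodup_append] at hn ⊢
      grind
    have hβα : f b + lw G L.flatten b = f a + lw G L.flatten a := by
      rw [hf a b hab, lw_tw G hab L.flatten haL hbL]
    have hbA : b ∉ A := by
      simp [List.nodup_append] at hn
      grind
    have hwA : lw G A b = 2 * A.length :=
      lw_all G A (fun v hv => (hT v hv b hb).adj (by rintro rfl; exact hbA hv))
    by_cases h1 : (∃ u ∈ A, ∃ w ∈ C, G.Adj u w) → 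
      f a + lw G L.flatten a ≤ f c + lw G L.flatten c ∨
      f a + lw G L.flatten a + 2 * A.length + 2 * C.length ≤ 2 ∨ 0 ≤ f c + lw G L.flatten c
    · exact left C S' rfl (swap_cost G hA hC hACn _ _ _ (cst _ _ hA hALd a ha)
        (cst _ _ hC hCLd c hc) h1)
    · push Not at h1
      obtain ⟨⟨a', ha', c', hc', hadj⟩, h2, h3, h4⟩ := h1
      have hACadj : ∀ u ∈ A, ∀ w ∈ C, G.Adj u w := by
        rcases hA.dich hC (List.nodup_append'.1 hACn).2.2 with h | h
        · exact h
        · exact absurd hadj (h a' ha' c' hc')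
      obtain ⟨S'', D, hSD⟩ : ∃ S'' D, C :: S' = S'' ++ [D] := by
        rcases List.eq_nil_or_concat (C :: S') with h | ⟨S'', D, h⟩
        · simp at h
        · exact ⟨S'', D, by simpa using h⟩
      have hD : Blk G D := hB D (by rw [hSD]; simp)
      obtain ⟨d, hd⟩ := List.exists_mem_of_ne_nil _ hD.1
      rw [hSD] at hn
      have hdD : (L ++ A :: S'').flatten.Disjoint D := by
        clear * - hn
        simp [List.nodup_append, List.Disjoint] at hn ⊢
        grind
      have hdB : (L ++ A :: S'').flatten.Disjoint B := by
        clear * - hn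
        simp [List.nodup_append, List.Disjoint] at hn ⊢
        grind
      have hDBn : (D ++ B).Nodup := by
        clear * - hn
        simp [List.nodup_append] at hn ⊢
        grind
      refine right D S'' hSD (swap_cost G hD hB' hDBn _ _ _ (cst _ _ hD hdD d hd)
        (cst _ _ hB' hdB b hb) ?_)
      intro _
      rcases S'' with _ | ⟨C', S''⟩
      · left
        simp only [List.nil_append, List.cons.injEq] at hSD
        obtain ⟨rfl, -⟩ := hSD
        have e1 : lw G (L ++ [A]).flatten b = lw G L.flatten b + 2 * A.length := by
          simp [lw_append, hwA]
        have e2 : lw G (L ++ [A]).flatten d = lw G L.flatten d + 2 * A.length := by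
          simp [lw_append]
          exact lw_all G A (fun v hv => hACadj v hv d hd)
        rw [e1, e2]
        have := cst _ _ hC hCLd c hc d hd
        linarith
      · right; right
        simp only [List.cons_append, List.cons.injEq] at hSD
        obtain ⟨rfl, -⟩ := hSD
        have hwC : lw G C b = 2 * C.length := by
          apply lw_all
          intro v hv
          have hva : v ≠ a := fun e => (List.nodup_append'.1 hACn).2.2 ha (e ▸ hv)
          have hvb : v ≠ b := by
            rintro rfl
            simp [List.nodup_append] at hn
            grind
          exact ((hab.adj_iff hva hvb).1 (hACadj a ha v hv)).symm
        have e1 : lw G (L ++ A :: C :: S'').flatten b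
            = lw G L.flatten b + 2 * A.length + 2 * C.length + lw G S''.flatten b := by
          simp [lw_append, hwA, hwC]; ring
        have := lw_nonneg G S''.flatten b
        rw [e1]
        linarith

end aux

section conv
variable {V : Type*} [Fintype V] (G : SimpleGraph V)

open Classical in
/-- initial state -/
noncomputable def st0 (v : V) : ℤ := - ∑ u : V, if G.Adj v u then 1 else 0

theorem st0_inv : TwInv G (st0 G) := by
  classical
  intro u w h
  by_cases e : u = w
  · rw [e]
  have key : ∀ z : V, (∑ x : V, if G.Adj z x ∨ x = z then (1:ℤ) else 0)
      = (∑ x : V, if G.Adj z x then (1:ℤ) else 0) + 1 := by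
    intro z
    have : (1 : ℤ) = ∑ x : V, if x = z then 1 else 0 := by simp
    rw [this, ← Finset.sum_add_distrib]
    apply Finset.sum_congr rfl
    intro x _
    by_cases hx : x = z
    · subst hx; simp
    · simp [hx]
  have h1 := key u
  have h2 := key w
  have h3 : (∑ x : V, if G.Adj u x ∨ x = u then (1:ℤ) else 0)
    = ∑ x : V, if G.Adj w x ∨ x = w then (1:ℤ) else 0 :=
    Finset.sum_congr rfl (fun x _ => by simp only [h x])
  have h4 : (∑ x : V, if G.Adj u x then (1:ℤ) else 0)
    = ∑ x : V, if G.Adj w x then (1:ℤ) else 0 := by linarith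
  unfold st0
  rw [neg_inj]
  convert h4

theorem lcost_ofFn {W : Type*} (G : SimpleGraph W) (n : ℕ) (g : Fin n → W) (f : W → ℤ) :
    lcost G f (List.ofFn g) =
      ∑ i, |f (g i) + ∑ j, if j < i then adjW G (g j) (g i) else 0| := by
  induction n generalizing f with
  | zero => simp [lcost]
  | succ n ih =>
    rw [List.ofFn_succ, lcost, ih, Fin.sum_univ_succ]
    congr 1
    · simp
    · apply Finset.sum_congr rfl
      intro i _
      rw [Fin.sum_univ_succ]
      simp [add_assoc]

theorem imbalance_eq (σ : V ≃ Fin (Fintype.card V)) :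
    imbalance G σ = lcost G (st0 G) (List.ofFn σ.symm) := by
  classical
  rw [lcost_ofFn, imbalance, ← Equiv.sum_comp σ]
  apply Finset.sum_congr rfl
  intro v _
  rw [← Equiv.sum_comp σ]
  simp only [Equiv.symm_apply_apply]
  congr 1
  unfold predCount succCount st0
  rw [Nat.card_eq_fintype_card, Nat.card_eq_fintype_card, Fintype.card_subtype,
    Fintype.card_subtype, Finset.card_filter, Finset.card_filter]
  push_cast
  rw [← Finset.sum_neg_distrib, ← Finset.sum_add_distrib, ← Finset.sum_sub_distrib]
  apply Finset.sum_congr rfl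
  intro u _
  unfold adjW
  rcases lt_trichotomy (σ u) (σ v) with h | h | h
  · simp only [h, not_lt_of_gt h, G.adj_comm u v]
    by_cases hh : G.Adj v u <;> simp [hh]
  · have : u = v := σ.injective h
    subst this; simp
  · simp only [h, not_lt_of_gt h, G.adj_comm u v]
    by_cases hh : G.Adj v u <;> simp [hh]

theorem exists_equiv (l : List V) (hn : l.Nodup) (hl : ∀ v, v ∈ l) :
    ∃ σ : V ≃ Fin (Fintype.card V), List.ofFn σ.symm = l := by
  classical
  have hc : l.length = Fintype.card V := by
    rw [← List.toFinset_card_of_nodup hn, ← Finset.card_univ]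
    congr 1
    ext v; simp [hl]
  refine ⟨((finCongr hc.symm).trans (hn.getEquivOfForallMemList l hl)).symm, ?_⟩
  apply List.ext_getElem
  · simp [hc]
  · intro i h1 h2
    simp

end conv

theorem stmt_15 {V : Type*} [Fintype V] (G : SimpleGraph V) :
    ∃ σ : V ≃ Fin (Fintype.card V),
      (∀ π : V ≃ Fin (Fintype.card V), imbalance G σ ≤ imbalance G π) ∧
      (∀ Y : Set V, IsTrueTwinSet G Y →
        (∀ Y' : Set V, Y ⊆ Y' → IsTrueTwinSet G Y' → Y' = Y) →
        ∀ u ∈ Y, ∀ w ∈ Y, ∀ x : V, σ u ≤ σ x → σ x ≤ σ w → x ∈ Y) := by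
  classical
  let OK : List (List V) → Prop := fun Ls => (∀ X ∈ Ls, Blk G X) ∧ Ls.flatten.Nodup ∧
    (∀ v, v ∈ Ls.flatten) ∧
    ∀ π : V ≃ Fin (Fintype.card V), lcost G (st0 G) Ls.flatten ≤ imbalance G π
  have hex : ∃ n, ∃ Ls, OK Ls ∧ Ls.length = n := by
    haveI : Nonempty (V ≃ Fin (Fintype.card V)) := ⟨Fintype.equivFin V⟩
    obtain ⟨σ, hσ⟩ := Finite.exists_min (fun σ : V ≃ Fin (Fintype.card V) => imbalance G σ)
    have hfl : ((List.ofFn σ.symm).map (fun v => [v])).flatten = List.ofFn σ.symm := by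
      induction (List.ofFn σ.symm) with
      | nil => rfl
      | cons x l ih => simp [ih]
    refine ⟨_, (List.ofFn σ.symm).map (fun v => [v]), ⟨?_, ?_, ?_, ?_⟩, rfl⟩
    · intro X hX
      obtain ⟨v, -, rfl⟩ := List.mem_map.1 hX
      refine ⟨by simp, ?_⟩
      intro u hu w hw
      rw [List.mem_singleton] at hu hw
      subst hu; subst hw
      exact fun x => Iff.rfl
    · rw [hfl, List.nodup_ofFn]; exact σ.symm.injective
    · intro v; rw [hfl, List.mem_ofFn]; exact σ.symm.surjective v
    · intro π; rw [hfl, ← imbalance_eq]; exact hσ π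
  obtain ⟨Ls, ⟨hB, hn, hall, hmin⟩, hlen⟩ := Nat.find_spec hex
  have hminlen : ∀ M, OK M → Ls.length ≤ M.length := by
    intro M hM
    rw [hlen]; exact Nat.find_min' hex ⟨M, hM, rfl⟩
  have hno : ∀ L A S B R, Ls = L ++ A :: (S ++ B :: R) → ∀ u ∈ A, ∀ w ∈ B, ¬ Tw G u w := by
    rintro L A S B R rfl u hu w hw h
    obtain ⟨M, h1, h2, h3, h4⟩ := reduce G (st0 G) (st0_inv G) _ L A S B R rfl hB hn (by
      intro u' hu' w' hw'
      exact (((hB A (by simp)).2 u' hu' u hu).trans h).trans ((hB B (by simp)).2 w hw w' hw'))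
    have := hminlen M ⟨h2, h3.nodup_iff.2 hn, fun v => h3.mem_iff.2 (hall v),
      fun π => h4.trans (hmin π)⟩
    omega
  obtain ⟨σ, hσ⟩ := exists_equiv Ls.flatten hn hall
  refine ⟨σ, fun π => by rw [imbalance_eq, hσ]; exact hmin π, ?_⟩
  have hord : ∀ P Q, Ls.flatten = P ++ Q → ∀ p ∈ P, ∀ q ∈ Q, σ p < σ q := by
    intro P Q hPQ p hp q hq
    have hpw : (List.ofFn σ.symm).Pairwise (fun a b => σ a < σ b) := by
      rw [List.pairwise_ofFn]
      intro i j hij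
      simpa using hij
    rw [hσ, hPQ, List.pairwise_append] at hpw
    exact hpw.2.2 p hp q hq
  intro Y hY hYmax u hu w hw x hux hxw
  have huw : Tw G u w := hY u hu w hw
  obtain ⟨A, hA, huA⟩ := List.mem_flatten.1 (hall u)
  obtain ⟨L, R, hLR⟩ := List.append_of_mem hA
  have hfl : Ls.flatten = L.flatten ++ (A ++ R.flatten) := by rw [hLR]; simp
  have hwA : w ∈ A := by
    have := hall w
    rw [hfl, List.mem_append, List.mem_append] at this
    rcases this with h | h | h
    · obtain ⟨B, hB1, hwB⟩ := List.mem_flatten.1 h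
      obtain ⟨L', S, rfl⟩ := List.append_of_mem hB1
      exact absurd huw.symm (hno L' B S A R (by rw [hLR]; simp) w hwB u huA)
    · exact h
    · obtain ⟨B, hB1, hwB⟩ := List.mem_flatten.1 h
      obtain ⟨S, R', rfl⟩ := List.append_of_mem hB1
      exact absurd huw (hno L A S B R' hLR u huA w hwB)
  have hxA : x ∈ A := by
    have := hall x
    rw [hfl, List.mem_append, List.mem_append] at this
    rcases this with h | h | h
    · exact absurd (hord _ _ hfl x h u (by simp [huA])) (not_lt.2 hux)
    · exact h
    · exact absurd (hord (L.flatten ++ A) R.flatten (by rw [hfl]; simp) w (by simp [hwA]) x h)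
        (not_lt.2 hxw)
  have hxu : Tw G x u := (hB A hA).2 x hxA u huA
  have htw : ∀ z ∈ insert x Y, Tw G z u := by
    intro z hz
    rcases hz with rfl | hz
    · exact hxu
    · exact hY z hz u hu
  have := hYmax (insert x Y) (Set.subset_insert _ _)
    (fun a ha b hb => (htw a ha).trans (htw b hb).symm)
  rw [← this]; exact Set.mem_insert _ _
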